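/- For every integer t ≥ 4 and every fixed element ω₀ ∈ M_{2^t}, the number of pairs (ω₁, ω₂) with ω₁ in the cyclic subgroup ⟨b·a⟩ and ω₂ in the cyclic subgroup ⟨a⟩ such that ω₁·ω₂ = ω₀ equals exactly 2^(t-2). Equivalently, if ω₁ and ω₂ are sampled independently and uniformly from ⟨b·a⟩ and ⟨a⟩ respectively, then the product ω₁·ω₂ is uniformly distributed on M_{2^t} (each fixed value ω₀ is attained with probability 2^{-t}). -/

import Mathlib

/-- The multiplier `2^(t-2)+1` squares to `1` modulo `2^(t-1)` when `t ≥ 3`. -/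
lemma Mmod.key (t : ℕ) (ht : 3 ≤ t) :
    ((2 ^ (t - 2) + 1 : ZMod (2 ^ (t - 1))) * (2 ^ (t - 2) + 1)) = 1 := by
  obtain ⟨s, rfl⟩ := Nat.exists_eq_add_of_le ht
  have h2 : 3 + s - 2 = s + 1 := by omega
  have h3 : 3 + s - 1 = s + 2 := by omega
  rw [h2, h3]
  have h0 : ((2 ^ (s + 2) : ℕ) : ZMod (2 ^ (s + 2))) = 0 := ZMod.natCast_self _
  push_cast at h0
  linear_combination ((2 : ZMod (2 ^ (s + 2))) ^ s + 1) * h0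

/-- The automorphism of `Multiplicative (ZMod (2^(t-1)))` given by multiplication of the
exponent by `2^(t-2)+1`. -/
def Mmod.uAut (t : ℕ) (ht : 3 ≤ t) :
    MulAut (Multiplicative (ZMod (2 ^ (t - 1)))) where
  toFun x := Multiplicative.ofAdd ((2 ^ (t - 2) + 1) * x.toAdd)
  invFun x := Multiplicative.ofAdd ((2 ^ (t - 2) + 1) * x.toAdd)
  left_inv x := by
    simp only [toAdd_ofAdd, ← mul_assoc, Mmod.key t ht, one_mul,
      ofAdd_toAdd]
  right_inv x := by
    simp only [toAdd_ofAdd, ← mul_assoc, Mmod.key t ht, one_mul,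
      ofAdd_toAdd]
  map_mul' x y := by
    simp only [toAdd_mul, mul_add, ofAdd_add]

lemma Mmod.uAut_sq (t : ℕ) (ht : 3 ≤ t) : (Mmod.uAut t ht) ^ 2 = 1 := by
  rw [pow_two]
  ext x
  show (Mmod.uAut t ht) ((Mmod.uAut t ht) x) = x
  show Multiplicative.ofAdd ((2 ^ (t - 2) + 1) *
    (Multiplicative.ofAdd ((2 ^ (t - 2) + 1) * x.toAdd)).toAdd) = x
  simp only [toAdd_ofAdd, ← mul_assoc, Mmod.key t ht, one_mul,
    ofAdd_toAdd]

/-- The action of `ZMod 2` on `ZMod (2^(t-1))` by multiplication by `2^(t-2)+1`. -/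
def Mmod.phi (t : ℕ) (ht : 3 ≤ t) :
    Multiplicative (ZMod 2) →* MulAut (Multiplicative (ZMod (2 ^ (t - 1)))) where
  toFun g := (Mmod.uAut t ht) ^ (g.toAdd.val)
  map_one' := by
    show (Mmod.uAut t ht) ^ ((0 : ZMod 2).val) = 1
    simp
  map_mul' := fun g h => by
    show (Mmod.uAut t ht) ^ ((g.toAdd + h.toAdd).val) =
      (Mmod.uAut t ht) ^ (g.toAdd.val) * (Mmod.uAut t ht) ^ (h.toAdd.val)
    rw [ZMod.val_add, ← pow_eq_pow_mod _ (Mmod.uAut_sq t ht), pow_add]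

/-- The modular maximal-cyclic group `M_{2^t}`, realized as the semidirect product
`(ZMod 2^(t-1)) ⋊ (ZMod 2)` where the nontrivial element of `ZMod 2` acts by
multiplication by `2^(t-2)+1`. -/
abbrev Mmod (t : ℕ) (ht : 3 ≤ t) :=
  SemidirectProduct (Multiplicative (ZMod (2 ^ (t - 1)))) (Multiplicative (ZMod 2))
    (Mmod.phi t ht)

/-- The generator `a` of `M_{2^t}`. -/
def Mmod.a (t : ℕ) (ht : 3 ≤ t) : Mmod t ht :=
  SemidirectProduct.inl (Multiplicative.ofAdd (1 : ZMod (2 ^ (t - 1))))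

/-- The generator `b` of `M_{2^t}`. -/
def Mmod.b (t : ℕ) (ht : 3 ≤ t) : Mmod t ht :=
  SemidirectProduct.inr (Multiplicative.ofAdd (1 : ZMod 2))


/-- The square of `b * a` is `a ^ (2 ^ (t - 2) + 2)`. -/
lemma Mmod.b_mul_a_sq (t : ℕ) (ht : 3 ≤ t) :
    (Mmod.b t ht * Mmod.a t ht) ^ 2 =
      SemidirectProduct.inl (Multiplicative.ofAdd (2 ^ (t - 2) + 2 : ZMod (2 ^ (t - 1)))) := by
  have hconj : Mmod.b t ht * Mmod.a t ht * Mmod.b t ht =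
      SemidirectProduct.inl
        (Multiplicative.ofAdd ((2 ^ (t - 2) + 1) * 1 : ZMod (2 ^ (t - 1)))) := by
    have hb : (Mmod.b t ht)⁻¹ = Mmod.b t ht := by
      rw [Mmod.b, ← map_inv]
      rfl
    have hphi : Mmod.phi t ht (Multiplicative.ofAdd 1) = Mmod.uAut t ht := pow_one _
    nth_rewrite 2 [← hb]
    rw [Mmod.b, Mmod.a, ← map_inv, ← SemidirectProduct.inl_aut, hphi]
    rfl
  rw [pow_two, ← mul_assoc, hconj, Mmod.a, ← map_mul, ← ofAdd_add]
  congr 2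
  ring

/-- For `t ≥ 4` the element `b * a` has order `2 ^ (t - 1)`. -/
lemma Mmod.orderOf_b_mul_a (t : ℕ) (ht3 : 3 ≤ t) (ht : 4 ≤ t) :
    orderOf (Mmod.b t ht3 * Mmod.a t ht3) = 2 ^ (t - 1) := by
  obtain ⟨s, rfl⟩ := Nat.exists_eq_add_of_le ht
  have h1 : 4 + s - 1 = s + 2 + 1 := by omega
  have h2 : 4 + s - 2 = s + 2 := by omega
  have hzero : (2 ^ (s + 3) : ZMod (2 ^ (4 + s - 1))) = 0 := by
    rw [h1]
    exact_mod_cast ZMod.natCast_self (2 ^ (s + 3))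
  have hne : (2 ^ (s + 2) : ZMod (2 ^ (4 + s - 1))) ≠ 0 := by
    rw [h1]
    intro h
    have h' : ((2 ^ (s + 2) : ℕ) : ZMod (2 ^ (s + 2 + 1))) = 0 := by exact_mod_cast h
    rw [ZMod.natCast_eq_zero_iff] at h'
    exact absurd (Nat.pow_dvd_pow_iff_le_right'.mp h') (by omega)
  have hpow (k : ℕ) : (Mmod.b (4 + s) ht3 * Mmod.a (4 + s) ht3) ^ 2 ^ (k + 1) = 1 ↔
      (2 ^ k * (2 ^ (s + 2) + 2) : ZMod (2 ^ (4 + s - 1))) = 0 := by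
    rw [pow_succ' 2 k, pow_mul, Mmod.b_mul_a_sq, ← map_pow, ← ofAdd_nsmul,
      map_eq_one_iff _ SemidirectProduct.inl_injective, ofAdd_eq_one, nsmul_eq_mul, h2]
    push_cast
    rfl
  refine (orderOf_eq_prime_pow (p := 2) (n := s + 2) ?_ ?_).trans (by rw [h1])
  · rw [hpow]
    intro h
    apply hne
    linear_combination h - 2 ^ s * hzero
  · rw [hpow]
    linear_combination (2 ^ (s + 1) + 1) * hzero

/-- The subgroup `⟨a⟩` is the kernel of the projection onto the `ZMod 2` factor. -/
lemma Mmod.zpowers_a (t : ℕ) (ht : 3 ≤ t) :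
    Subgroup.zpowers (Mmod.a t ht) =
      (SemidirectProduct.rightHom : Mmod t ht →* Multiplicative (ZMod 2)).ker := by
  rw [← SemidirectProduct.range_inl_eq_ker_rightHom]
  ext x
  simp only [Subgroup.mem_zpowers_iff, MonoidHom.mem_range, Mmod.a, ← map_zpow, ← ofAdd_zsmul,
    zsmul_one]
  constructor
  · rintro ⟨k, hk⟩
    exact ⟨_, hk⟩
  · rintro ⟨y, rfl⟩
    obtain ⟨k, hk⟩ := ZMod.intCast_surjective y.toAdd
    exact ⟨k, by rw [hk, ofAdd_toAdd]⟩

/-- In a group, pairs in `H × f.ker` with product `g` correspond to the elements of `H`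
lying over `f g`. -/
def Subgroup.pairsMulEqEquivFiber {G K : Type*} [Group G] [Group K] (H : Subgroup G)
    (f : G →* K) (g : G) :
    {p : G × G // p.1 ∈ H ∧ p.2 ∈ f.ker ∧ p.1 * p.2 = g} ≃
      (f.comp H.subtype) ⁻¹' {f g} where
  toFun p := ⟨⟨p.1.1, p.2.1⟩, by
    obtain ⟨⟨x, y⟩, -, hy, rfl⟩ := p
    simp [f.mem_ker.mp hy]⟩
  invFun h := ⟨(h.1.1, h.1.1⁻¹ * g), h.1.2, by
    have hh : f h.1.1 = f g := h.2
    simp [MonoidHom.mem_ker, hh], by simp⟩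
  left_inv := by
    rintro ⟨⟨x, y⟩, -, -, rfl⟩
    simp
  right_inv _ := rfl

/-- For every integer `t ≥ 4` and every fixed element `ω₀ ∈ M_{2^t}`, the number of pairs
`(ω₁, ω₂)` with `ω₁ ∈ ⟨b*a⟩` and `ω₂ ∈ ⟨a⟩` such that `ω₁*ω₂ = ω₀` equals exactly
`2^(t-2)`; equivalently, the product of independent uniform samples from `⟨b*a⟩` and `⟨a⟩`
is uniformly distributed on `M_{2^t}` (each fixed value is attained with probability
`2^(-t)`). -/
theorem statement15 (t : ℕ) (ht3 : 3 ≤ t) (ht : 4 ≤ t) (ω₀ : Mmod t ht3) :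
    Nat.card {p : Mmod t ht3 × Mmod t ht3 //
      p.1 ∈ Subgroup.zpowers (Mmod.b t ht3 * Mmod.a t ht3) ∧
      p.2 ∈ Subgroup.zpowers (Mmod.a t ht3) ∧ p.1 * p.2 = ω₀} = 2 ^ (t - 2) := by
  let f : Mmod t ht3 →* Multiplicative (ZMod 2) := SemidirectProduct.rightHom
  let H := Subgroup.zpowers (Mmod.b t ht3 * Mmod.a t ht3)
  have hf : f (Mmod.b t ht3 * Mmod.a t ht3) = Multiplicative.ofAdd 1 := by
    simp [f, Mmod.a, Mmod.b]
  have hsurj : Function.Surjective (f.comp H.subtype) := by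
    intro z
    obtain ⟨k, hk⟩ := ZMod.intCast_surjective z.toAdd
    refine ⟨⟨_, k, rfl⟩, ?_⟩
    simp only [MonoidHom.comp_apply, Subgroup.subtype_apply, map_zpow, hf, ← ofAdd_zsmul,
      zsmul_one, hk, ofAdd_toAdd]
  have hcard := (f.comp H.subtype).ker.card_mul_index
  rw [Subgroup.index_ker, MonoidHom.range_eq_top.mpr hsurj, Subgroup.card_top,
    Nat.card_zpowers, Mmod.orderOf_b_mul_a t ht3 ht, Nat.card_congr Multiplicative.toAdd,
    Nat.card_zmod] at hcard
  have hpow : 2 ^ (t - 1) = 2 ^ (t - 2) * 2 := by rw [← pow_succ]; congr 1; omega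
  rw [Mmod.zpowers_a, Nat.card_congr (H.pairsMulEqEquivFiber f ω₀),
    Nat.card_congr ((f.comp H.subtype).fiberEquivKerOfSurjective hsurj (f ω₀))]
  exact Nat.eq_of_mul_eq_mul_right two_pos (hcard.trans hpow)
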